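/- arXiv:2403.12148 — 2 statements merged into one kernel-verified Lean document; each statement's English description precedes it below -/
import Mathlib

section
/- Let c1, c2, c3, c4 be generic real numbers, N ≥ 0 an integer, and c0 = −2N−3−c1−c2−c3−c4. For all integers i, j, x, y ≥ 0 with i+j ≤ N and x+y ≤ N, the Tratnik polynomials of Racah type satisfy the nine-term difference equation ( μ_i(c_{23}) + (1/2)(c2+1)(c3+1) ) · T_{i,j}(x,y) = Σ over ε, ε' in {−1, 0, +1} of D^{ε,ε'}(x,y; c1,c2,c3,c4) · T_{i,j}(x+ε, y+ε'). -/
open Finset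

noncomputable section

/-- Pochhammer symbol `(a)_k = a (a+1) ⋯ (a+k-1)`. -/
def poch (a : ℝ) (k : ℕ) : ℝ := ∏ i ∈ Finset.range k, (a + i)

/-- A real number is *generic* if it is not an integer. -/
def Generic (r : ℝ) : Prop := ∀ m : ℤ, r ≠ (m : ℝ)

/-- Genericity for three parameters: none of the parameters, nor any sum of two or three
of them, is an integer; this guarantees that no denominator vanishes. -/
def Generic3 (c1 c2 c3 : ℝ) : Prop :=
  Generic c1 ∧ Generic c2 ∧ Generic c3 ∧
  Generic (c1+c2) ∧ Generic (c1+c3) ∧ Generic (c2+c3) ∧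
  Generic (c1+c2+c3)

/-- Genericity for four parameters: none of the parameters, nor any sum of two, three or
four of them, is an integer; this guarantees that no denominator vanishes. -/
def Generic4 (c1 c2 c3 c4 : ℝ) : Prop :=
  Generic c1 ∧ Generic c2 ∧ Generic c3 ∧ Generic c4 ∧
  Generic (c1+c2) ∧ Generic (c1+c3) ∧ Generic (c1+c4) ∧
  Generic (c2+c3) ∧ Generic (c2+c4) ∧ Generic (c3+c4) ∧
  Generic (c1+c2+c3) ∧ Generic (c1+c2+c4) ∧ Generic (c1+c3+c4) ∧ Generic (c2+c3+c4) ∧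
  Generic (c1+c2+c3+c4)

/-- Normalization `Ω(n; c1,c2,c3; M)`. -/
def Om (n : ℤ) (c1 c2 c3 : ℝ) (M : ℤ) : ℝ :=
  (M.toNat.choose n.toNat : ℝ) * (2*(n:ℝ) + c2 + c3 + 1) *
    poch (c2+1) n.toNat * poch ((M:ℝ)+2+c1+c2+c3) n.toNat * poch (c1+1) (M-n).toNat /
    (poch (c3+1) n.toNat * poch (c2+c3+(n:ℝ)+1) (M.toNat+1))

/-- The renormalized Racah polynomial `p_n(x; c1,c2,c3; M)`, with the convention that it
vanishes unless `0 ≤ n ≤ M`. -/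
def racah (n : ℤ) (x : ℝ) (c1 c2 c3 : ℝ) (M : ℤ) : ℝ :=
  if 0 ≤ n ∧ n ≤ M then
    Om n c1 c2 c3 M *
      ∑ k ∈ Finset.range (n.toNat + 1),
        (poch (-(n:ℝ)) k * poch ((n:ℝ)+c2+c3+1) k * poch (-x) k * poch (x+c1+c2+1) k) /
        (poch (c2+1) k * poch ((M:ℝ)+2+c1+c2+c3) k * poch (-(M:ℝ)) k * (Nat.factorial k : ℝ))
  else 0

/-- Weight `Λ(x; c1,c2; M)`. -/
def Lam (x : ℤ) (c1 c2 : ℝ) (M : ℤ) : ℝ :=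
  (-1:ℝ)^x.toNat * (M.toNat.choose x.toNat : ℝ) * (2*(x:ℝ)+c1+c2+1) * poch (c2+1) x.toNat /
    (poch (c1+1) x.toNat * poch ((x:ℝ)+c1+c2+1) (M.toNat+1))

/-- `λ(x; c) = x(x+c+1)`. -/
def lam (x c : ℝ) : ℝ := x*(x+c+1)

/-- `μ_n(c) = n(n+c+1)`. -/
def mu (n c : ℝ) : ℝ := n*(n+c+1)

/-- Recurrence coefficient `A_n(c1,c2,c3; M)`. -/
def coefA (n c1 c2 c3 M : ℝ) : ℝ :=
  (n-M)*(n+c1+c2+c3+M+2)*(n+c2+1)*(n+c2+c3+1)/((2*n+c2+c3+1)*(2*n+c2+c3+2))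

/-- Recurrence coefficient `C_n(c1,c2,c3; M)`. -/
def coefC (n c1 c2 c3 M : ℝ) : ℝ :=
  n*(n-c1-M-1)*(n+c2+c3+M+1)*(n+c3)/((2*n+c2+c3)*(2*n+c2+c3+1))

/-- `Σ_n = A_n + C_n`. -/
def coefSig (n c1 c2 c3 M : ℝ) : ℝ := coefA n c1 c2 c3 M + coefC n c1 c2 c3 M

/-- Difference coefficient `B(x; c1,c2,c3; M)`. -/
def coefB (x c1 c2 c3 M : ℝ) : ℝ :=
  (x-M)*(x+c2+1)*(x+c1+c2+c3+M+2)*(x+c1+c2+1)/((2*x+c1+c2+1)*(2*x+c1+c2+2))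

/-- Difference coefficient `D(x; c1,c2,c3; M)`. -/
def coefD (x c1 c2 c3 M : ℝ) : ℝ :=
  x*(x+c1)*(x-c3-M-1)*(x+c1+c2+M+1)/((2*x+c1+c2)*(2*x+c1+c2+1))

/-- `S = B + D`. -/
def coefS (x c1 c2 c3 M : ℝ) : ℝ := coefB x c1 c2 c3 M + coefD x c1 c2 c3 M

/-- `F(x; c1,c2)`. -/
def Ffun (x c1 c2 : ℝ) : ℝ :=
  (x+c2+1)*(x+c1+c2+1)/((2*x+c1+c2+1)*(2*x+c1+c2+2))

/-- `λ⁺(x; c12; M) = (x+c12+M+2)(x−M−1)`. -/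
def lamP (x c12 M : ℝ) : ℝ := (x+c12+M+2)*(x-M-1)

/-- `A⁺_n(c2,c3; M)`. -/
def Ap (n c2 c3 M : ℝ) : ℝ := -(n-M-1)*(n-M)*Ffun n c3 c2

/-- `C⁺_n(c2,c3; M) = A⁺_{−n−c23−1}(c2,c3; M)`. -/
def Cp (n c2 c3 M : ℝ) : ℝ := Ap (-n-c2-c3-1) c2 c3 M

/-- `Σ⁺_n = A⁺_n + C⁺_n + (M+1)(M+1+c3)`. -/
def Sp (n c2 c3 M : ℝ) : ℝ := Ap n c2 c3 M + Cp n c2 c3 M + (M+1)*(M+1+c3)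

/-- `λ⁻(x; c123, c3; M) = (x+c123+M+1)(x−M−c3)`. -/
def lamM (x c123 c3 M : ℝ) : ℝ := (x+c123+M+1)*(x-M-c3)

/-- `A⁻_n(c1,c2,c3; M)`. -/
def Am (n c1 c2 c3 M : ℝ) : ℝ := -(n+c1+c2+c3+M+1)*(n+c1+c2+c3+M+2)*Ffun n c3 c2

/-- `C⁻_n(c1,c2,c3; M) = A⁻_{−n−c23−1}(c1,c2,c3; M)`. -/
def Cm (n c1 c2 c3 M : ℝ) : ℝ := Am (-n-c2-c3-1) c1 c2 c3 M

/-- `Σ⁻_n = A⁻_n + C⁻_n + (M+c12+1)(M+c123+1)`. -/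
def Sm (n c1 c2 c3 M : ℝ) : ℝ :=
  Am n c1 c2 c3 M + Cm n c1 c2 c3 M + (M+c1+c2+1)*(M+c1+c2+c3+1)

/-- `μ⁺_n(c123, c1; M) = (n+c123+M+2)(n−M−1−c1)`. -/
def muP (n c123 c1 M : ℝ) : ℝ := (n+c123+M+2)*(n-M-1-c1)

/-- `B⁺(x; c1,c2,c3; M)`. -/
def Bp (x c1 c2 c3 M : ℝ) : ℝ := -(x+c1+c2+c3+M+2)*(x+c1+c2+c3+M+3)*Ffun x c1 c2

/-- `D⁺(x; c1,c2,c3; M) = B⁺(−x−c12−1; c1,c2,c3; M)`. -/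
def Dp (x c1 c2 c3 M : ℝ) : ℝ := Bp (-x-c1-c2-1) c1 c2 c3 M

/-- `S⁺ = B⁺ + D⁺ + (c23+M+2)(c123+M+2)`. -/
def SpD (x c1 c2 c3 M : ℝ) : ℝ :=
  Bp x c1 c2 c3 M + Dp x c1 c2 c3 M + (c2+c3+M+2)*(c1+c2+c3+M+2)

/-- `μ⁻_n(c23; M) = (n−M)(n+c23+M+1)`. -/
def muM (n c23 M : ℝ) : ℝ := (n-M)*(n+c23+M+1)

/-- `B⁻(x; c1,c2; M)`. -/
def Bm (x c1 c2 M : ℝ) : ℝ := -(x-M)*(x-M+1)*Ffun x c1 c2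

/-- `D⁻(x; c1,c2; M) = B⁻(−x−c12−1; c1,c2; M)`. -/
def Dm (x c1 c2 M : ℝ) : ℝ := Bm (-x-c1-c2-1) c1 c2 M

/-- `S⁻ = B⁻ + D⁻ + M(c1+M)`. -/
def SmD (x c1 c2 M : ℝ) : ℝ := Bm x c1 c2 M + Dm x c1 c2 M + M*(c1+M)

/-- Nine-point recurrence coefficients `A^{e,e'}_{i,j}(c1,c2,c3,c4)` (with
`c0 = −2N−3−c1−c2−c3−c4`). -/
def nineA (e e' : ℤ) (i j : ℝ) (c1 c2 c3 c4 N : ℝ) : ℝ :=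
  let c0 : ℝ := -2*N-3-c1-c2-c3-c4
  if e = 1 ∧ e' = 1 then -(Ffun (-j-c0-c4-1) c4 c0) * Cm i c1 c2 c3 (N-j+1)
  else if e = 0 ∧ e' = 1 then (Ffun (-j-c0-c4-1) c4 c0) * Sm i c1 c2 c3 (N-j+1)
  else if e = -1 ∧ e' = 1 then -(Ffun (-j-c0-c4-1) c4 c0) * Am i c1 c2 c3 (N-j+1)
  else if e = 1 ∧ e' = -1 then -(Ffun j c4 c0) * Cp i c2 c3 (N-j-1)
  else if e = 0 ∧ e' = -1 then (Ffun j c4 c0) * Sp i c2 c3 (N-j-1)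
  else if e = -1 ∧ e' = -1 then -(Ffun j c4 c0) * Ap i c2 c3 (N-j-1)
  else if e = 1 ∧ e' = 0 then (Ffun j c4 c0 + Ffun (-j-c0-c4-1) c4 c0) * coefC i c1 c2 c3 (N-j)
  else if e = 0 ∧ e' = 0 then
    -(Ffun j c4 c0 + Ffun (-j-c0-c4-1) c4 c0) *
      (coefSig i c1 c2 c3 (N-j) + (N-j)^2 + (c1+c2+c3+2)*(N-j) + (1/2)*(c3+1)*(c1+c2+c3+1))
  else if e = -1 ∧ e' = 0 then (Ffun j c4 c0 + Ffun (-j-c0-c4-1) c4 c0) * coefA i c1 c2 c3 (N-j)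
  else 0

/-- `Γ^{0,0}_{i,j}(c1,c2,c3,c4)`. -/
def gam00 (i j : ℝ) (c1 c2 c3 c4 N : ℝ) : ℝ :=
  let c0 : ℝ := -2*N-3-c1-c2-c3-c4
  (-(coefSig i c1 c2 c3 (N-j)) + coefSig j c1 c0 c4 (N-i) - (1/4)*(c3^2-c4^2)
    + (i-N-(1/2)*(c4+1))*(i+(1/2)*(c2+c3-c0-c1))
    - (j-N-(1/2)*(c3+1))*(j+(1/2)*(c0+c4-c1-c2)))

/-- `Γ^{e,e'}_{i,j}` coefficients. -/
def gam (e e' : ℤ) (i j : ℝ) (c1 c2 c3 c4 N : ℝ) : ℝ :=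
  let c0 : ℝ := -2*N-3-c1-c2-c3-c4
  if e = 0 ∧ e' = 1 then coefC j c1 c0 c4 (N-i)
  else if e = 0 ∧ e' = -1 then coefA j c1 c0 c4 (N-i)
  else if e = 1 ∧ e' = 0 then coefC i c1 c2 c3 (N-j)
  else if e = -1 ∧ e' = 0 then coefA i c1 c2 c3 (N-j)
  else if e = 0 ∧ e' = 0 then gam00 i j c1 c2 c3 c4 N
  else 0

/-- Nine-point difference coefficients `D^{e,e'}(x,y; c1,c2,c3,c4)` (with
`c0 = −2N−3−c1−c2−c3−c4`). -/
def nineD (e e' : ℤ) (x y : ℝ) (c1 c2 c3 c4 N : ℝ) : ℝ :=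
  let c0 : ℝ := -2*N-3-c1-c2-c3-c4
  if e = 1 ∧ e' = 1 then -(Ffun x c1 c2) * Bm y c3 c0 (N-x)
  else if e = 1 ∧ e' = 0 then (Ffun x c1 c2) * SmD y c3 c0 (N-x)
  else if e = 1 ∧ e' = -1 then -(Ffun x c1 c2) * Dm y c3 c0 (N-x)
  else if e = -1 ∧ e' = 1 then -(Ffun (-x-c1-c2-1) c1 c2) * Bp y c3 c0 c4 (N-x)
  else if e = -1 ∧ e' = 0 then (Ffun (-x-c1-c2-1) c1 c2) * SpD y c3 c0 c4 (N-x)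
  else if e = -1 ∧ e' = -1 then -(Ffun (-x-c1-c2-1) c1 c2) * Dp y c3 c0 c4 (N-x)
  else if e = 0 ∧ e' = 1 then (Ffun x c1 c2 + Ffun (-x-c1-c2-1) c1 c2) * coefB y c3 c0 c4 (N-x)
  else if e = 0 ∧ e' = 0 then
    -(Ffun x c1 c2 + Ffun (-x-c1-c2-1) c1 c2) *
      (coefS y c3 c0 c4 (N-x) + (N-x)^2 + (c0+c3+c4+2)*(N-x) + (1/2)*(c3+1)*(c0+c3+c4+1))
  else if e = 0 ∧ e' = -1 then (Ffun x c1 c2 + Ffun (-x-c1-c2-1) c1 c2) * coefD y c3 c0 c4 (N-x)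
  else 0

/-- `Ψ^{a,b}(x,y)` coefficients: the first superscript refers to the shift in `y`,
the second to the shift in `x` (with `c0 = −2N−3−c1−c2−c3−c4`). -/
def psi (a b : ℤ) (x y : ℝ) (c1 c2 c3 c4 N : ℝ) : ℝ :=
  let c0 : ℝ := -2*N-3-c1-c2-c3-c4
  if a = 0 ∧ b = 1 then coefB x c4 c2 c1 (N-y)
  else if a = 0 ∧ b = -1 then coefD x c4 c2 c1 (N-y)
  else if a = 1 ∧ b = 0 then coefB y c3 c0 c1 (N-x)
  else if a = -1 ∧ b = 0 then coefD y c3 c0 c1 (N-x)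
  else if a = 0 ∧ b = 0 then gam00 x y c1 c2 c4 c3 N
  else 0

/-- Tratnik polynomial of Racah type `T_{i,j}(x,y; c1,c2,c3,c4; N)`, set to `0` outside
the triangular domains. -/
def trat (c1 c2 c3 c4 : ℝ) (Nn : ℕ) (i j x y : ℤ) : ℝ :=
  let c0 : ℝ := -2*(Nn:ℝ)-3-c1-c2-c3-c4
  if 0 ≤ i ∧ 0 ≤ j ∧ i + j ≤ (Nn:ℤ) ∧ 0 ≤ x ∧ 0 ≤ y ∧ x + y ≤ (Nn:ℤ) then
    racah i (x:ℝ) c1 c2 c3 ((Nn:ℤ)-j) * racah j (y:ℝ) c3 c0 c4 ((Nn:ℤ)-x)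
  else 0

/-- Griffiths polynomial of Racah type `G_{i,j}(x,y; c1,c2,c3,c4; N)`, set to `0` outside
the triangular domains. -/
def grif (c1 c2 c3 c4 : ℝ) (Nn : ℕ) (i j x y : ℤ) : ℝ :=
  let c0 : ℝ := -2*(Nn:ℝ)-3-c1-c2-c3-c4
  if 0 ≤ i ∧ 0 ≤ j ∧ i + j ≤ (Nn:ℤ) ∧ 0 ≤ x ∧ 0 ≤ y ∧ x + y ≤ (Nn:ℤ) then
    ∑ a ∈ Finset.range (((Nn:ℤ)-j).toNat + 1),
      (-1:ℝ)^a * racah i (a:ℝ) c1 c2 c3 ((Nn:ℤ)-j) * racah j (y:ℝ) c3 c0 c4 ((Nn:ℤ)-(a:ℤ)) *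
        racah (a:ℤ) (x:ℝ) c4 c2 c1 ((Nn:ℤ)-y)
  else 0

/-- Krawtchouk polynomial `K_n(x; p; M)`, set to `0` unless `0 ≤ n ≤ M`. -/
def kraw (n : ℤ) (x : ℝ) (p : ℝ) (M : ℤ) : ℝ :=
  if 0 ≤ n ∧ n ≤ M then
    (M.toNat.choose n.toNat : ℝ) * (p/(1-p))^n.toNat *
      ∑ k ∈ Finset.range (n.toNat + 1),
        poch (-(n:ℝ)) k * poch (-x) k / (poch (-(M:ℝ)) k * (Nat.factorial k : ℝ)) * (1/p)^k
  else 0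

/-- The coefficient of `(-x)_k (x+c1+c2+1)_k` in the hypergeometric sum of the Racah polynomial. -/
def racahCoeff (n c1 c2 c3 M : ℝ) (k : ℕ) : ℝ :=
  poch (-n) k * poch (n+c2+c3+1) k /
    (poch (c2+1) k * poch (M+2+c1+c2+c3) k * poch (-M) k * (Nat.factorial k : ℝ))

/-- The symmetric basis `(-x)_k (x+c1+c2+1)_k`. -/
def racahBasis (x c1 c2 : ℝ) (k : ℕ) : ℝ := poch (-x) k * poch (x+c1+c2+1) k

/-- The hypergeometric sum of the Racah polynomial, without normalization. -/
def racahSum (n : ℕ) (x c1 c2 c3 M : ℝ) : ℝ :=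
  ∑ k ∈ range (n+1), racahCoeff n c1 c2 c3 M k * racahBasis x c1 c2 k

theorem poch_succ (a : ℝ) (k : ℕ) : poch a (k+1) = poch a k * (a + k) :=
  Finset.prod_range_succ _ _

theorem mul_poch_add_one (a : ℝ) (k : ℕ) : a * poch (a+1) k = poch a k * (a + k) := by
  induction k with
  | zero => simp [poch]
  | succ k ih =>
    rw [poch_succ, poch_succ, ← mul_assoc, ih]
    push_cast
    ring

theorem poch_ne_zero {a : ℝ} {k : ℕ} (h : ∀ i < k, a + (i:ℝ) ≠ 0) : poch a k ≠ 0 :=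
  Finset.prod_ne_zero_iff.2 fun i hi => h i (Finset.mem_range.1 hi)

theorem poch_neg_eq_zero {m k : ℕ} (h : m < k) : poch (-(m:ℝ)) k = 0 :=
  Finset.prod_eq_zero (Finset.mem_range.2 h) (neg_add_cancel _)

theorem Generic.add_int_ne {c : ℝ} (h : Generic c) (m : ℤ) : c + (m:ℝ) ≠ 0 := by
  intro h0
  exact h (-m) (by push_cast; linarith)

theorem Generic.add_int {c : ℝ} (h : Generic c) (m : ℤ) : Generic (c + (m:ℝ)) := by
  intro k hk
  exact h (k - m) (by push_cast; linarith)

theorem Generic.neg {c : ℝ} (h : Generic c) : Generic (-c) := by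
  intro k hk
  exact h (-k) (by push_cast; linarith)

theorem Generic.poch_add_ne_zero {c : ℝ} (h : Generic c) (m : ℤ) (k : ℕ) :
    poch (c + (m:ℝ)) k ≠ 0 :=
  poch_ne_zero fun i _ => (h.add_int m).add_int_ne i

theorem racah_natCast {n M : ℕ} (h : n ≤ M) (x c1 c2 c3 : ℝ) :
    racah n x c1 c2 c3 M = Om n c1 c2 c3 M * racahSum n x c1 c2 c3 M := by
  rw [racah, if_pos ⟨Int.natCast_nonneg n, by exact_mod_cast h⟩]
  simp only [racahSum, racahCoeff, racahBasis, Int.toNat_natCast, Int.cast_natCast]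
  congr 1
  refine Finset.sum_congr rfl fun k _ => ?_
  ring

theorem racah_of_lt {n M : ℤ} (h : M < n) (x c1 c2 c3 : ℝ) : racah n x c1 c2 c3 M = 0 :=
  if_neg fun h' => absurd h'.2 (not_le.2 h)

theorem racahBasis_add_one (x c1 c2 : ℝ) (k : ℕ) :
    (x+c1+c2+1) * racahBasis (x+1) c1 c2 (k+1) =
      -(x+1) * (x+c1+c2+k+1) * (x+c1+c2+k+2) * racahBasis x c1 c2 k := by
  have h1 := mul_poch_add_one (-(x+1)) k
  have h2 := mul_poch_add_one (x+c1+c2+1) k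
  have h3 : -(x+1)+1 = -x := by ring
  have h4 : x+1+c1+c2+1 = x+c1+c2+1+1 := by ring
  rw [h3] at h1
  simp only [racahBasis, poch_succ, h4]
  linear_combination (-(x+c1+c2+1)*poch (x+c1+c2+1+1) k*(x+c1+c2+1+1+k)) * h1
    + (-(x+1)*poch (-x) k*(x+c1+c2+1+1+k)) * h2

theorem racahBasis_sub_one (x c1 c2 : ℝ) (k : ℕ) :
    x * racahBasis (x-1) c1 c2 (k+1) =
      -(k-x) * (k+1-x) * (x+c1+c2) * racahBasis x c1 c2 k := by
  have h1 := mul_poch_add_one (-x) k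
  have h2 := mul_poch_add_one (x+c1+c2) k
  have h3 : -(x-1) = -x+1 := by ring
  have h4 : x-1+c1+c2+1 = x+c1+c2 := by ring
  simp only [racahBasis, poch_succ, h3, h4]
  linear_combination (-(poch (x+c1+c2) k * (x+c1+c2+k) * (-x+1+k))) * h1
    + (poch (-x) k * (-x+k) * (-x+1+k)) * h2

theorem Ffun_reflect (x c1 c2 : ℝ) :
    Ffun (-x-c1-c2-1) c1 c2 = x*(x+c1)/((2*x+c1+c2)*(2*x+c1+c2+1)) := by
  rw [Ffun]
  congr 1 <;> ring

/-- Action on the symmetric basis of a second-order difference operator whose coefficients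
are `Ffun` times a quadratic polynomial and its reflection. -/
theorem diffOp_racahBasis_succ {x c1 c2 : ℝ} (h0 : 2*x+c1+c2 ≠ 0) (h1 : 2*x+c1+c2+1 ≠ 0)
    (h2 : 2*x+c1+c2+2 ≠ 0) (g : ℝ → ℝ) (a b d : ℝ) (hg : ∀ t, g t = a*t^2+b*t+d) (k : ℕ) :
    Ffun x c1 c2 * g x * (racahBasis (x+1) c1 c2 (k+1) - racahBasis x c1 c2 (k+1))
      + Ffun (-x-c1-c2-1) c1 c2 * g (-x-c1-c2-1) *
        (racahBasis (x-1) c1 c2 (k+1) - racahBasis x c1 c2 (k+1)) =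
      (k+1) * (a*(k-c1)+b) * racahBasis x c1 c2 (k+1)
        - (k+1) * (k+1+c2) * g k * racahBasis x c1 c2 k := by
  have e1 := racahBasis_add_one x c1 c2 k
  have e2 := racahBasis_sub_one x c1 c2 k
  have e3 : racahBasis x c1 c2 (k+1) = (k-x)*(x+c1+c2+k+1) * racahBasis x c1 c2 k := by
    simp only [racahBasis, poch_succ]
    ring
  have f1 : Ffun x c1 c2 * (racahBasis (x+1) c1 c2 (k+1) - racahBasis x c1 c2 (k+1)) =
      -(k+1)*(x+c2+1)*(x+c1+c2+k+1)/(2*x+c1+c2+1) * racahBasis x c1 c2 k := by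
    rw [Ffun, e3, div_mul_eq_mul_div, div_mul_eq_mul_div, div_eq_div_iff (mul_ne_zero h1 h2) h1]
    linear_combination ((x+c2+1) * (2*x+c1+c2+1)) * e1
  have f2 : Ffun (-x-c1-c2-1) c1 c2 * (racahBasis (x-1) c1 c2 (k+1) - racahBasis x c1 c2 (k+1)) =
      -(k+1)*(x+c1)*(k-x)/(2*x+c1+c2+1) * racahBasis x c1 c2 k := by
    rw [Ffun_reflect, e3, div_mul_eq_mul_div, div_mul_eq_mul_div,
      div_eq_div_iff (mul_ne_zero h0 h1) h1]
    linear_combination ((x+c1) * (2*x+c1+c2+1)) * e2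
  have f3 : -(k+1)*(x+c2+1)*(x+c1+c2+k+1)/(2*x+c1+c2+1) * g x
      + -(k+1)*(x+c1)*(k-x)/(2*x+c1+c2+1) * g (-x-c1-c2-1) =
      (k+1) * (a*(k-c1)+b) * ((k-x)*(x+c1+c2+k+1)) - (k+1) * (k+1+c2) * g k := by
    simp only [hg]
    rw [div_mul_eq_mul_div, div_mul_eq_mul_div, ← add_div, div_eq_iff h1]
    ring
  rw [e3] at f1 f2 ⊢
  linear_combination g x * f1 + g (-x-c1-c2-1) * f2 + racahBasis x c1 c2 k * f3

theorem diffOp_sum_racahBasis {x c1 c2 : ℝ} (h0 : 2*x+c1+c2 ≠ 0) (h1 : 2*x+c1+c2+1 ≠ 0)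
    (h2 : 2*x+c1+c2+2 ≠ 0) (g : ℝ → ℝ) (a b d : ℝ) (hg : ∀ t, g t = a*t^2+b*t+d)
    (u : ℕ → ℝ) (n : ℕ) :
    Ffun x c1 c2 * g x * (∑ k ∈ range (n+1), u k * racahBasis (x+1) c1 c2 k
          - ∑ k ∈ range (n+1), u k * racahBasis x c1 c2 k)
      + Ffun (-x-c1-c2-1) c1 c2 * g (-x-c1-c2-1) *
        (∑ k ∈ range (n+1), u k * racahBasis (x-1) c1 c2 k
          - ∑ k ∈ range (n+1), u k * racahBasis x c1 c2 k) =
      ∑ k ∈ range (n+1), (u k * (k * (a*(k-1-c1)+b)) - u (k+1) * ((k+1)*(k+1+c2)*g k))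
          * racahBasis x c1 c2 k
        + u (n+1) * ((n+1)*(n+1+c2)*g n) * racahBasis x c1 c2 n := by
  induction n with
  | zero => simp [racahBasis, poch]
  | succ n ih =>
    have key := diffOp_racahBasis_succ h0 h1 h2 g a b d hg n
    rw [Finset.sum_range_succ _ (n+1), Finset.sum_range_succ _ (n+1),
      Finset.sum_range_succ _ (n+1), Finset.sum_range_succ _ (n+1)]
    push_cast
    linear_combination ih + u (n+1) * key

theorem racahCoeff_succ_self (n : ℕ) (c1 c2 c3 M : ℝ) : racahCoeff n c1 c2 c3 M (n+1) = 0 := by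
  simp [racahCoeff, poch_neg_eq_zero (Nat.lt_succ_self n)]

theorem diffOp_racahSum {x c1 c2 : ℝ} (h0 : 2*x+c1+c2 ≠ 0) (h1 : 2*x+c1+c2+1 ≠ 0)
    (h2 : 2*x+c1+c2+2 ≠ 0) (g : ℝ → ℝ) (a b d : ℝ) (hg : ∀ t, g t = a*t^2+b*t+d)
    (e c3 M : ℝ) (n : ℕ) :
    Ffun x c1 c2 * g x * racahSum n (x+1) c1 c2 c3 M
      - (Ffun x c1 c2 * g x + Ffun (-x-c1-c2-1) c1 c2 * g (-x-c1-c2-1) + e)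
        * racahSum n x c1 c2 c3 M
      + Ffun (-x-c1-c2-1) c1 c2 * g (-x-c1-c2-1) * racahSum n (x-1) c1 c2 c3 M =
      ∑ k ∈ range (n+1), (racahCoeff n c1 c2 c3 M k * (k * (a*(k-1-c1)+b) - e)
        - racahCoeff n c1 c2 c3 M (k+1) * ((k+1)*(k+1+c2)*g k)) * racahBasis x c1 c2 k := by
  have key := diffOp_sum_racahBasis h0 h1 h2 g a b d hg (racahCoeff n c1 c2 c3 M) n
  rw [racahCoeff_succ_self] at key
  have split : ∑ k ∈ range (n+1), (racahCoeff n c1 c2 c3 M k * (k * (a*(k-1-c1)+b) - e)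
        - racahCoeff n c1 c2 c3 M (k+1) * ((k+1)*(k+1+c2)*g k)) * racahBasis x c1 c2 k =
      ∑ k ∈ range (n+1), (racahCoeff n c1 c2 c3 M k * (k * (a*(k-1-c1)+b))
        - racahCoeff n c1 c2 c3 M (k+1) * ((k+1)*(k+1+c2)*g k)) * racahBasis x c1 c2 k
      - e * racahSum n x c1 c2 c3 M := by
    rw [racahSum, Finset.mul_sum, ← Finset.sum_sub_distrib]
    refine Finset.sum_congr rfl fun k _ => ?_
    ring
  rw [split]
  simp only [racahSum]
  linear_combination key

theorem Generic.poch_one_ne_zero {c : ℝ} (h : Generic c) (k : ℕ) : poch (c+1) k ≠ 0 := by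
  simpa using h.poch_add_ne_zero 1 k

theorem Generic.poch_natCast_ne_zero {c1 c2 c3 : ℝ} (h : Generic (c1+c2+c3)) (M k : ℕ) :
    poch ((M:ℝ)+2+c1+c2+c3) k ≠ 0 := by
  have := h.poch_add_ne_zero (M+2) k
  convert this using 2
  push_cast
  ring

theorem poch_neg_ne_zero {M k : ℕ} (h : k ≤ M) : poch (-(M:ℝ)) k ≠ 0 :=
  poch_ne_zero fun i hi h0 => by
    have h1 : (i:ℝ) = M := by linarith
    have h2 : i = M := by exact_mod_cast h1
    omega

theorem racahCoeff_succ {c1 c2 c3 : ℝ} (hc2 : Generic c2) (hc : Generic (c1+c2+c3))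
    {n M k : ℕ} (hkM : k ≤ n) (hnM : n ≤ M) :
    racahCoeff n c1 c2 c3 M (k+1) * ((k+1)*(k+1+c2)*(M+2+c1+c2+c3+k)*(k-M)) =
      racahCoeff n c1 c2 c3 M k * ((k-n)*(n+c2+c3+1+k)) := by
  rcases hkM.eq_or_lt with rfl | hlt
  · rw [racahCoeff_succ_self]
    ring
  have p1 := hc2.poch_one_ne_zero (k+1)
  have p2 := hc.poch_natCast_ne_zero M (k+1)
  have p3 := poch_neg_ne_zero (M := M) (k := k+1) (by omega)
  have p4 : (k:ℝ)+1 ≠ 0 := by positivity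
  have p5 : (Nat.factorial k : ℝ) ≠ 0 := by positivity
  simp only [racahCoeff]
  rw [poch_succ] at p1 p2 p3
  simp only [poch_succ, Nat.factorial_succ]
  push_cast
  have q1 := left_ne_zero_of_mul p1
  have q2 := left_ne_zero_of_mul p2
  have q3 := left_ne_zero_of_mul p3
  have r1 := right_ne_zero_of_mul p1
  have r2 := right_ne_zero_of_mul p2
  have r3 := right_ne_zero_of_mul p3
  field_simp
  ring

theorem racahCoeff_size_succ {c1 c2 c3 : ℝ} (hc2 : Generic c2) (hc : Generic (c1+c2+c3))
    (n : ℝ) {M k : ℕ} (hkM : k ≤ M) :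
    racahCoeff n c1 c2 c3 (M+1) k * ((M+2+c1+c2+c3+k)*(M+1)) =
      racahCoeff n c1 c2 c3 M k * ((M+2+c1+c2+c3)*(M+1-k)) := by
  have p1 := hc2.poch_one_ne_zero k
  have p2 := hc.poch_natCast_ne_zero M k
  have p3 := poch_neg_ne_zero hkM
  have p4 := hc.poch_natCast_ne_zero (M+1) k
  have p5 := poch_neg_ne_zero (M := M+1) (k := k) (by omega)
  have p6 : (Nat.factorial k : ℝ) ≠ 0 := by positivity
  have e1 := mul_poch_add_one ((M:ℝ)+2+c1+c2+c3) k
  have e2 := mul_poch_add_one (-((M:ℝ)+1)) k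
  rw [show (M:ℝ)+2+c1+c2+c3+1 = M+1+2+c1+c2+c3 by ring] at e1
  rw [show -((M:ℝ)+1)+1 = -M by ring] at e2
  push_cast at p4 p5
  have d1 := mul_ne_zero (mul_ne_zero (mul_ne_zero p1 p2) p3) p6
  have d2 := mul_ne_zero (mul_ne_zero (mul_ne_zero p1 p4) p5) p6
  rw [racahCoeff, racahCoeff, div_mul_eq_mul_div, div_mul_eq_mul_div, div_eq_div_iff d2 d1]
  linear_combination (-(poch (-n) k * poch (n+c2+c3+1) k * poch (c2+1) k * k.factorial)) *
    ((M+1) * poch (-(M:ℝ)) k * e1 + (M+2+c1+c2+c3) * poch (M+1+2+c1+c2+c3) k * e2)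

theorem Om_size_succ {c1 c2 c3 : ℝ} (hc3 : Generic c3) (hc23 : Generic (c2+c3))
    {n M : ℕ} (h : n ≤ M) :
    Om n c1 c2 c3 (M+1) * ((M+1-n)*(M+2+c1+c2+c3)*(c2+c3+n+M+2)) =
      Om n c1 c2 c3 M * ((M+1)*(M+2+c1+c2+c3+n)*(c1+1+M-n)) := by
  have p1 := hc3.poch_one_ne_zero n
  have p2 : poch (c2+c3+n+1) (M+1+1) ≠ 0 := by
    simpa [add_assoc] using hc23.poch_add_ne_zero (n+1) (M+1+1)
  have e1 := mul_poch_add_one ((M:ℝ)+2+c1+c2+c3) n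
  rw [show (M:ℝ)+2+c1+c2+c3+1 = M+1+2+c1+c2+c3 by ring] at e1
  have e2 : ((M+1).choose n : ℝ) * (M+1-n) = M.choose n * (M+1) := by
    have := Nat.choose_mul_succ_eq M n
    have h' : ((M + 1 - n : ℕ) : ℝ) = M+1-n := by
      rw [Nat.cast_sub (by omega)]
      push_cast
      ring
    rw [← h']
    exact_mod_cast this.symm
  have t1 : ((M:ℤ)+1).toNat = M+1 := by omega
  have t2 : ((M:ℤ)+1-n).toNat = (M-n)+1 := by omega
  have t3 : ((M:ℤ)-n).toNat = M-n := by omega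
  simp only [Om, t1, t2, t3, Int.toNat_natCast, Int.cast_natCast]
  rw [poch_succ (c2+c3+n+1) (M+1)] at p2 ⊢
  rw [poch_succ (c1+1), Nat.cast_sub h]
  push_cast at p2 ⊢
  have d1 := mul_ne_zero p1 p2
  have d2 := mul_ne_zero p1 (left_ne_zero_of_mul p2)
  rw [div_mul_eq_mul_div, div_mul_eq_mul_div, div_eq_div_iff d1 d2]
  linear_combination ((2*n+c2+c3+1) * poch (c2+1) n * poch (c1+1) (M-n) * (c1+1+M-n)
      * (c2+c3+n+M+2) * poch (c3+1) n * poch (c2+c3+n+1) (M+1)) *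
    ((M+2+c1+c2+c3) * poch (M+1+2+c1+c2+c3) n * e2 + M.choose n * (M+1) * e1)

theorem coefB_eq (x c1 c2 c3 M : ℝ) :
    coefB x c1 c2 c3 M = Ffun x c1 c2 * ((x-M)*(x+c1+c2+c3+M+2)) := by
  rw [coefB, Ffun]
  ring

theorem coefD_eq (x c1 c2 c3 M : ℝ) :
    coefD x c1 c2 c3 M = Ffun (-x-c1-c2-1) c1 c2 *
      ((-x-c1-c2-1-M)*(-x-c1-c2-1+c1+c2+c3+M+2)) := by
  rw [coefD, Ffun_reflect]
  ring

/-- The second-order difference equation of the Racah polynomials. -/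
theorem racah_difference {x c1 c2 c3 : ℝ} (hc2 : Generic c2) (hc : Generic (c1+c2+c3))
    (h0 : 2*x+c1+c2 ≠ 0) (h1 : 2*x+c1+c2+1 ≠ 0) (h2 : 2*x+c1+c2+2 ≠ 0)
    {n M : ℤ} (hn : 0 ≤ n) :
    coefB x c1 c2 c3 M * racah n (x+1) c1 c2 c3 M - coefS x c1 c2 c3 M * racah n x c1 c2 c3 M
      + coefD x c1 c2 c3 M * racah n (x-1) c1 c2 c3 M = mu n (c2+c3) * racah n x c1 c2 c3 M := by
  rcases lt_or_ge M n with h | h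
  · simp [racah_of_lt h]
  lift n to ℕ using hn
  lift M to ℕ using by omega
  have hnM : n ≤ M := by exact_mod_cast h
  simp only [racah_natCast hnM, coefS, coefB_eq, coefD_eq, Int.cast_natCast]
  have key := diffOp_racahSum h0 h1 h2 (fun t => (t-M)*(t+c1+c2+c3+M+2))
    1 (c1+c2+c3+2) (-M*(c1+c2+c3+M+2)) (fun t => by ring) 0 c3 M n
  have hsum : ∀ k ∈ range (n+1), (racahCoeff n c1 c2 c3 M k * (k * (1*(k-1-c1)+(c1+c2+c3+2)) - 0)
        - racahCoeff n c1 c2 c3 M (k+1) * ((k+1)*(k+1+c2)*((k-M)*(k+c1+c2+c3+M+2))))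
        * racahBasis x c1 c2 k = mu n (c2+c3) * (racahCoeff n c1 c2 c3 M k * racahBasis x c1 c2 k) := by
    intro k hk
    have := racahCoeff_succ hc2 hc (Nat.lt_succ_iff.1 (Finset.mem_range.1 hk)) hnM
    rw [mu]
    linear_combination (-racahBasis x c1 c2 k) * this
  rw [Finset.sum_congr rfl hsum, ← Finset.mul_sum] at key
  change _ = _ * racahSum n x c1 c2 c3 M at key
  linear_combination Om n c1 c2 c3 M * key

/-- The contiguity relation of the Racah polynomials raising the size `M - 1` to `M`. -/
theorem racah_contiguity_down {x c1 c2 c3 : ℝ} (hc2 : Generic c2) (hc3 : Generic c3)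
    (hc23 : Generic (c2+c3)) (hc : Generic (c1+c2+c3))
    (h0 : 2*x+c1+c2 ≠ 0) (h1 : 2*x+c1+c2+1 ≠ 0) (h2 : 2*x+c1+c2+2 ≠ 0)
    {n M : ℤ} (hn : 0 ≤ n) :
    Bm x c1 c2 M * racah n (x+1) c1 c2 c3 (M-1) - SmD x c1 c2 M * racah n x c1 c2 c3 (M-1)
      + Dm x c1 c2 M * racah n (x-1) c1 c2 c3 (M-1) =
      muM n (c2+c3) M * racah n x c1 c2 c3 M := by
  rcases lt_or_ge M n with h | h
  · simp [racah_of_lt h, racah_of_lt (show M - 1 < n by omega)]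
  rcases h.eq_or_lt with rfl | hlt
  · simp [racah_of_lt (show n - 1 < n by omega), muM]
  obtain ⟨m, rfl⟩ : ∃ m, M = m + 1 := ⟨M-1, by ring⟩
  lift n to ℕ using hn
  lift m to ℕ using by omega
  have hnM : n ≤ m := by omega
  rw [add_sub_cancel_right, ← Nat.cast_succ]
  simp only [racah_natCast hnM, racah_natCast (Nat.le_succ_of_le hnM), SmD, Bm, Dm,
    Int.cast_natCast]
  have key := diffOp_racahSum h0 h1 h2 (fun t => -(t-(m+1))*(t-(m+1)+1))
    (-1) (2*m+1) (-(m+1)*m) (fun t => by ring) ((m+1)*(c1+m+1)) c3 m n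
  have hA : (m:ℝ)+2+c1+c2+c3 ≠ 0 := by
    have := hc.add_int_ne (m+2)
    push_cast at this
    contrapose! this
    linarith
  have hsum : ∀ k ∈ range (n+1), (racahCoeff n c1 c2 c3 m k *
        (k * (-1*(k-1-c1)+(2*m+1)) - (m+1)*(c1+m+1))
        - racahCoeff n c1 c2 c3 m (k+1) * ((k+1)*(k+1+c2)*(-(k-(m+1))*(k-(m+1)+1))))
        * racahBasis x c1 c2 k =
      -((m+1)*(m+1+c1-n)*(n+m+2+c1+c2+c3)/(m+2+c1+c2+c3)) *
        (racahCoeff n c1 c2 c3 (m+1) k * racahBasis x c1 c2 k) := by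
    intro k hk
    have hkn := Nat.lt_succ_iff.1 (Finset.mem_range.1 hk)
    have r1 := racahCoeff_succ hc2 hc hkn hnM
    have r2 := racahCoeff_size_succ hc2 hc n (hkn.trans hnM)
    have hAk : (m:ℝ)+2+c1+c2+c3+k ≠ 0 := by
      have := hc.add_int_ne (m+2+k)
      push_cast at this
      contrapose! this
      linarith
    refine (congrArg (· * racahBasis x c1 c2 k) ?_).trans (mul_assoc _ _ _)
    rw [← neg_div, div_mul_eq_mul_div, eq_div_iff hA]
    refine mul_right_cancel₀ hAk ?_
    linear_combination ((k-(m+1))*(m+2+c1+c2+c3)) * r1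
      + ((m+1+c1-n)*(n+m+2+c1+c2+c3)) * r2
  rw [Finset.sum_congr rfl hsum, ← Finset.mul_sum] at key
  change _ = _ * racahSum n x c1 c2 c3 (m+1) at key
  have hOm : Om n c1 c2 c3 m * ((m+1)*(m+1+c1-n)*(n+m+2+c1+c2+c3)/(m+2+c1+c2+c3)) =
      Om n c1 c2 c3 (m+1) * ((m+1-n)*(c2+c3+n+m+2)) := by
    rw [mul_div_assoc', div_eq_iff hA]
    linear_combination -Om_size_succ (c1 := c1) hc3 hc23 hnM
  rw [muM]
  push_cast
  linear_combination Om n c1 c2 c3 m * key - racahSum n x c1 c2 c3 (m+1) * hOm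

/-- The contiguity relation of the Racah polynomials lowering the size `M + 1` to `M`. -/
theorem racah_contiguity_up {x c1 c2 c3 : ℝ} (hc2 : Generic c2) (hc3 : Generic c3)
    (hc23 : Generic (c2+c3)) (hc : Generic (c1+c2+c3))
    (h0 : 2*x+c1+c2 ≠ 0) (h1 : 2*x+c1+c2+1 ≠ 0) (h2 : 2*x+c1+c2+2 ≠ 0)
    {n M : ℤ} (hn : 0 ≤ n) (hx : ∃ y : ℕ, x = y ∧ (y:ℤ) ≤ M) :
    Bp x c1 c2 c3 M * racah n (x+1) c1 c2 c3 (M+1)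
      - SpD x c1 c2 c3 M * racah n x c1 c2 c3 (M+1)
      + Dp x c1 c2 c3 M * racah n (x-1) c1 c2 c3 (M+1) =
      muP n (c1+c2+c3) c1 M * racah n x c1 c2 c3 M := by
  rcases lt_or_ge (M+1) n with h | h
  · simp [racah_of_lt h, racah_of_lt (show M < n by omega)]
  obtain ⟨y, hxy, hyM⟩ := hx
  lift n to ℕ using hn
  lift M to ℕ using by omega
  have hnM : n ≤ M+1 := by omega
  rw [← Nat.cast_succ]
  simp only [racah_natCast hnM, SpD, Bp, Dp, Int.cast_natCast]
  have key := diffOp_racahSum h0 h1 h2 (fun t => -(t+c1+c2+c3+M+2)*(t+c1+c2+c3+M+3))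
    (-1) (-(2*(c1+c2+c3+M+2)+1)) (-(c1+c2+c3+M+2)*(c1+c2+c3+M+3)) (fun t => by ring)
    ((c2+c3+M+2)*(c1+c2+c3+M+2)) c3 (M+1) n
  have hcoeff : ∀ k ∈ range (n+1), (racahCoeff n c1 c2 c3 (M+1) k *
        (k * (-1*(k-1-c1)+(-(2*(c1+c2+c3+M+2)+1))) - (c2+c3+M+2)*(c1+c2+c3+M+2))
        - racahCoeff n c1 c2 c3 (M+1) (k+1) *
          ((k+1)*(k+1+c2)*(-(k+c1+c2+c3+M+2)*(k+c1+c2+c3+M+3)))) * (k-(M+1)) =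
      racahCoeff n c1 c2 c3 (M+1) k *
        ((k+c1+c2+c3+M+2)*(M+1-n)*(M+n+c2+c3+2)) := by
    intro k hk
    have r1 := racahCoeff_succ hc2 hc (Nat.lt_succ_iff.1 (Finset.mem_range.1 hk)) hnM
    push_cast at r1
    linear_combination (k+c1+c2+c3+M+2) * r1
  rcases hnM.eq_or_lt with rfl | hlt
  · have hsum : ∀ k ∈ range (M+1+1), (racahCoeff (M+1:ℕ) c1 c2 c3 (M+1) k *
        (k * (-1*(k-1-c1)+(-(2*(c1+c2+c3+M+2)+1))) - (c2+c3+M+2)*(c1+c2+c3+M+2))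
        - racahCoeff (M+1:ℕ) c1 c2 c3 (M+1) (k+1) *
          ((k+1)*(k+1+c2)*(-(k+c1+c2+c3+M+2)*(k+c1+c2+c3+M+3)))) * racahBasis x c1 c2 k = 0 := by
      intro k hk
      rcases (Nat.lt_succ_iff.1 (Finset.mem_range.1 hk)).eq_or_lt with rfl | hkM
      · rw [racahBasis, hxy, poch_neg_eq_zero (by omega)]
        ring
      · have := hcoeff k hk
        have hne : (k:ℝ)-(M+1) ≠ 0 := by
          have : (k:ℝ) < M+1 := by exact_mod_cast hkM
          linarith
        refine mul_eq_zero_of_left (mul_right_cancel₀ hne ?_) _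
        rw [this]
        push_cast
        ring
    rw [Finset.sum_congr rfl hsum, Finset.sum_const_zero] at key
    rw [racah_of_lt (show (M:ℤ) < (M+1:ℕ) by omega)]
    push_cast at key ⊢
    linear_combination Om (M+1) c1 c2 c3 (M+1) * key
  have hnM' : n ≤ M := Nat.lt_succ_iff.1 hlt
  rw [racah_natCast hnM']
  have hm : (M:ℝ)+1 ≠ 0 := by positivity
  have hsum : ∀ k ∈ range (n+1), (racahCoeff n c1 c2 c3 (M+1) k *
        (k * (-1*(k-1-c1)+(-(2*(c1+c2+c3+M+2)+1))) - (c2+c3+M+2)*(c1+c2+c3+M+2))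
        - racahCoeff n c1 c2 c3 (M+1) (k+1) *
          ((k+1)*(k+1+c2)*(-(k+c1+c2+c3+M+2)*(k+c1+c2+c3+M+3)))) * racahBasis x c1 c2 k =
      -((M+2+c1+c2+c3)*(M+1-n)*(M+n+c2+c3+2)/(M+1)) *
        (racahCoeff n c1 c2 c3 M k * racahBasis x c1 c2 k) := by
    intro k hk
    have hkM : k ≤ M := (Nat.lt_succ_iff.1 (Finset.mem_range.1 hk)).trans hnM'
    have r2 := racahCoeff_size_succ hc2 hc n hkM
    have hne : (k:ℝ)-(M+1) ≠ 0 := by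
      have : (k:ℝ) ≤ M := by exact_mod_cast hkM
      linarith
    refine (congrArg (· * racahBasis x c1 c2 k) ?_).trans (mul_assoc _ _ _)
    refine mul_right_cancel₀ hne ?_
    rw [hcoeff k hk, neg_mul, neg_mul, div_mul_eq_mul_div, div_mul_eq_mul_div, ← neg_div,
      eq_div_iff hm]
    linear_combination ((M+1-n)*(M+n+c2+c3+2)) * r2
  rw [Finset.sum_congr rfl hsum, ← Finset.mul_sum] at key
  change _ = _ * racahSum n x c1 c2 c3 M at key
  have hOm : Om n c1 c2 c3 (M+1) * ((M+2+c1+c2+c3)*(M+1-n)*(M+n+c2+c3+2)/(M+1)) =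
      Om n c1 c2 c3 M * ((M+2+c1+c2+c3+n)*(c1+1+M-n)) := by
    rw [mul_div_assoc', div_eq_iff hm]
    linear_combination Om_size_succ (c1 := c1) hc3 hc23 hnM'
  rw [muP]
  push_cast
  linear_combination Om n c1 c2 c3 (M+1) * key - racahSum n x c1 c2 c3 M * hOm

theorem SmD_self {c1 c2 M : ℝ} (h0 : 2*M+c1+c2 ≠ 0) (h1 : 2*M+c1+c2+1 ≠ 0) :
    SmD M c1 c2 M = 0 := by
  have key : Ffun (-M-c1-c2-1) c1 c2 * ((2*M+c1+c2)*(2*M+c1+c2+1)) = M*(M+c1) := by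
    rw [Ffun_reflect, div_mul_cancel₀ _ (mul_ne_zero h0 h1)]
  simp only [SmD, Bm, Dm]
  linear_combination -key

theorem mul_trat_eq (c1 c2 c3 c4 : ℝ) {Nn : ℕ} {i j x y : ℤ} {d : ℝ}
    (hi : 0 ≤ i) (hj : 0 ≤ j) (hij : i + j ≤ (Nn:ℤ))
    (h : (0 ≤ x ∧ 0 ≤ y ∧ x + y ≤ (Nn:ℤ)) ∨ d = 0) :
    d * trat c1 c2 c3 c4 Nn i j x y =
      d * (racah i x c1 c2 c3 (Nn-j) * racah j y c3 (-2*(Nn:ℝ)-3-c1-c2-c3-c4) c4 (Nn-x)) := by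
  rcases h with h | h
  · rw [trat, if_pos ⟨hi, hj, hij, h⟩]
  · rw [h, zero_mul, zero_mul]

theorem Generic.two_mul_add_ne {c1 c2 : ℝ} (h : Generic (c1+c2)) (x : ℤ) :
    2*(x:ℝ)+c1+c2 ≠ 0 ∧ 2*(x:ℝ)+c1+c2+1 ≠ 0 ∧ 2*(x:ℝ)+c1+c2+2 ≠ 0 := by
  have e0 := h.add_int_ne (2*x)
  have e1 := h.add_int_ne (2*x+1)
  have e2 := h.add_int_ne (2*x+2)
  push_cast at e0 e1 e2
  refine ⟨?_, ?_, ?_⟩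
  · contrapose! e0; linarith
  · contrapose! e1; linarith
  · contrapose! e2; linarith

/-- The diagonal coefficient of the Racah difference operator in terms of that of the
nine-point operator. -/
theorem Ffun_add_reflect_mul {x c1 c2 : ℝ} (h0 : 2*x+c1+c2 ≠ 0) (h1 : 2*x+c1+c2+1 ≠ 0)
    (h2 : 2*x+c1+c2+2 ≠ 0) (c3 c4 N j : ℝ) :
    let c0 := -2*N-3-c1-c2-c3-c4
    (Ffun x c1 c2 + Ffun (-x-c1-c2-1) c1 c2) * (mu j (c0+c4) -
      ((N-x)^2 + (c0+c3+c4+2)*(N-x) + (1/2)*(c3+1)*(c0+c3+c4+1))) =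
    (1/2)*(c2+1)*(c3+1) - coefS x c1 c2 c3 (N-j) := by
  intro c0
  have e1 : Ffun x c1 c2 * (2*x+c1+c2+2) = (x+c2+1)*(x+c1+c2+1)/(2*x+c1+c2+1) := by
    rw [Ffun, div_mul_eq_mul_div, mul_div_mul_right _ _ h2]
  have e2 : Ffun (-x-c1-c2-1) c1 c2 * (2*x+c1+c2) = x*(x+c1)/(2*x+c1+c2+1) := by
    rw [Ffun_reflect, div_mul_eq_mul_div, mul_comm (2*x+c1+c2), mul_div_mul_right _ _ h0]
  have e3 : (x+c2+1)*(x+c1+c2+1)/(2*x+c1+c2+1) - x*(x+c1)/(2*x+c1+c2+1) = c2+1 := by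
    rw [← sub_div, div_eq_iff h1]
    ring
  simp only [c0, coefS, coefB_eq, coefD_eq, mu]
  linear_combination (1/2)*(c3+1)*(e1 - e2 + e3)

theorem sum_neg_one_zero_one (f : ℤ → ℝ) :
    ∑ e ∈ ({-1,0,1} : Finset ℤ), f e = f (-1) + (f 0 + f 1) := by
  rw [Finset.sum_insert (by decide), Finset.sum_pair (by decide)]

/-- nine-term difference equation for the Tratnik polynomials of Racah
type. -/
theorem tratnik_difference_x
    (Nn : ℕ) (c1 c2 c3 c4 : ℝ) (hgen : Generic4 c1 c2 c3 c4)
    (i j x y : ℤ) (hi : 0 ≤ i) (hj : 0 ≤ j) (hij : i + j ≤ (Nn:ℤ))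
    (hx : 0 ≤ x) (hy : 0 ≤ y) (hxy : x + y ≤ (Nn:ℤ)) :
    (mu (i:ℝ) (c2+c3) + (1/2)*(c2+1)*(c3+1)) * trat c1 c2 c3 c4 Nn i j x y =
      ∑ e ∈ ({-1,0,1} : Finset ℤ), ∑ e' ∈ ({-1,0,1} : Finset ℤ),
        nineD e e' (x:ℝ) (y:ℝ) c1 c2 c3 c4 (Nn:ℝ) *
          trat c1 c2 c3 c4 Nn i j (x+e) (y+e') := by
  obtain ⟨-, g2, -, g4, g12, -, -, -, -, -, g123, g124, -, -, g1234⟩ := hgen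
  set c0 : ℝ := -2*(Nn:ℝ)-3-c1-c2-c3-c4 with hc0
  have g0 : Generic c0 := by
    convert g1234.neg.add_int (-2*Nn-3) using 1
    rw [hc0]; push_cast; ring
  have g04 : Generic (c0+c4) := by
    convert g123.neg.add_int (-2*Nn-3) using 1
    rw [hc0]; push_cast; ring
  have g30 : Generic (c3+c0) := by
    convert g124.neg.add_int (-2*Nn-3) using 1
    rw [hc0]; push_cast; ring
  have g304 : Generic (c3+c0+c4) := by
    convert g12.neg.add_int (-2*Nn-3) using 1
    rw [hc0]; push_cast; ring
  obtain ⟨x0, x1, x2⟩ := g12.two_mul_add_ne x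
  obtain ⟨y0, y1, y2⟩ := g30.two_mul_add_ne y
  have hX := racah_difference (M := Nn-j) g2 g123 x0 x1 x2 hi
  have hY := racah_difference (M := Nn-x) g0 g304 y0 y1 y2 hj
  have hD := racah_contiguity_down (M := Nn-x) g0 g4 g04 g304 y0 y1 y2 hj
  have hU := racah_contiguity_up (M := Nn-x) g0 g4 g04 g304 y0 y1 y2 hj
    ⟨y.toNat, by exact_mod_cast (Int.toNat_of_nonneg hy).symm, by omega⟩
  have hS := Ffun_add_reflect_mul x0 x1 x2 c3 c4 Nn j
  simp only [← hc0] at hS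
  have term : ∀ e e' : ℤ, (0 ≤ x+e ∧ 0 ≤ y+e' ∧ x+e+(y+e') ≤ Nn) ∨
      nineD e e' x y c1 c2 c3 c4 Nn = 0 →
      nineD e e' x y c1 c2 c3 c4 Nn * trat c1 c2 c3 c4 Nn i j (x+e) (y+e') =
      nineD e e' x y c1 c2 c3 c4 Nn *
        (racah i (x+e:ℤ) c1 c2 c3 (Nn-j) * racah j (y+e':ℤ) c3 c0 c4 (Nn-(x+e))) :=
    fun e e' h => mul_trat_eq c1 c2 c3 c4 hi hj hij h
  have reflect_zero : ∀ a b : ℝ, Ffun (-0-a-b-1) a b = 0 := fun a b => by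
    rw [Ffun_reflect]; simp
  have edge : x + y = Nn → (y:ℝ) = Nn - x := fun h => by
    rw [eq_sub_iff_add_eq']; exact_mod_cast h
  have subedge : x + y + 1 = Nn → (y:ℝ) = Nn - x - 1 := fun h => by
    have : (x:ℝ) + y + 1 = Nn := by exact_mod_cast h
    linarith
  have dpp : nineD 1 1 x y c1 c2 c3 c4 Nn = -(Ffun x c1 c2) * Bm y c3 c0 (Nn-x) := by
    simp [nineD, hc0]
  have dpz : nineD 1 0 x y c1 c2 c3 c4 Nn = Ffun x c1 c2 * SmD y c3 c0 (Nn-x) := by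
    simp [nineD, hc0]
  have dpm : nineD 1 (-1) x y c1 c2 c3 c4 Nn = -(Ffun x c1 c2) * Dm y c3 c0 (Nn-x) := by
    simp [nineD, hc0]
  have dmp : nineD (-1) 1 x y c1 c2 c3 c4 Nn =
      -(Ffun (-x-c1-c2-1) c1 c2) * Bp y c3 c0 c4 (Nn-x) := by
    simp [nineD, hc0]
  have dmz : nineD (-1) 0 x y c1 c2 c3 c4 Nn =
      Ffun (-x-c1-c2-1) c1 c2 * SpD y c3 c0 c4 (Nn-x) := by
    simp [nineD, hc0]
  have dmm : nineD (-1) (-1) x y c1 c2 c3 c4 Nn =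
      -(Ffun (-x-c1-c2-1) c1 c2) * Dp y c3 c0 c4 (Nn-x) := by
    simp [nineD, hc0]
  have dzp : nineD 0 1 x y c1 c2 c3 c4 Nn =
      (Ffun x c1 c2 + Ffun (-x-c1-c2-1) c1 c2) * coefB y c3 c0 c4 (Nn-x) := by
    simp [nineD, hc0]
  have dzz : nineD 0 0 x y c1 c2 c3 c4 Nn = -(Ffun x c1 c2 + Ffun (-x-c1-c2-1) c1 c2) *
      (coefS y c3 c0 c4 (Nn-x) + (Nn-x)^2 + (c0+c3+c4+2)*(Nn-x)
        + (1/2)*(c3+1)*(c0+c3+c4+1)) := by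
    simp [nineD, hc0]
  have dzm : nineD 0 (-1) x y c1 c2 c3 c4 Nn =
      (Ffun x c1 c2 + Ffun (-x-c1-c2-1) c1 c2) * coefD y c3 c0 c4 (Nn-x) := by
    simp [nineD, hc0]
  have y_edge : 0 < y ∨ (y:ℝ) = 0 :=
    hy.lt_or_eq.imp_right fun h => by exact_mod_cast h.symm
  have x_edge : ∀ e' : ℤ, -1 ≤ e' → e' ≤ 1 → (e' = -1 → 0 < y) →
      (0 ≤ x+(-1) ∧ 0 ≤ y+e' ∧ x+(-1)+(y+e') ≤ Nn) ∨ (x:ℝ) = 0 := by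
    intro e' h1 h2 h3
    rcases hx.eq_or_lt with h | hx'
    · right; exact_mod_cast h.symm
    · left; omega
  have tpp := term 1 1 <| by
    by_cases h : x + y + 2 ≤ Nn
    · left; omega
    · right
      rcases (show x + y = Nn ∨ x + y + 1 = Nn by omega) with h | h
      · rw [dpp, Bm, edge h, sub_self]; ring
      · rw [dpp, Bm, subedge h]; ring
  have tpz := term 1 0 <| by
    by_cases h : x + y + 1 ≤ Nn
    · left; omega
    · right
      have hy' := edge (by omega)
      rw [dpz, ← hy', SmD_self y0 y1, mul_zero]
  have tpm := term 1 (-1) <| by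
    refine y_edge.imp (fun h => by omega) fun h => ?_
    rw [dpm, Dm, Bm, h, reflect_zero, mul_zero, mul_zero]
  have tzp := term 0 1 <| by
    by_cases h : x + y + 1 ≤ Nn
    · left; omega
    · right
      rw [dzp, coefB, edge (by omega)]
      simp
  have tzz := term 0 0 <| by left; omega
  have tzm := term 0 (-1) <| by
    refine y_edge.imp (fun h => by omega) fun h => ?_
    rw [dzm, coefD, h]
    simp
  have tmp := term (-1) 1 <| (x_edge 1 (by omega) (by omega) (by omega)).imp_right fun h => by
    rw [dmp, h, reflect_zero, neg_zero, zero_mul]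
  have tmz := term (-1) 0 <| (x_edge 0 (by omega) (by omega) (by omega)).imp_right fun h => by
    rw [dmz, h, reflect_zero, zero_mul]
  have tmm := term (-1) (-1) <| by
    rcases y_edge with hy' | h
    swap
    · right; rw [dmm, Dp, Bp, h, reflect_zero, mul_zero, mul_zero]
    · exact (x_edge (-1) (by omega) (by omega) (fun _ => hy')).imp_right fun h => by
        rw [dmm, h, reflect_zero, neg_zero, zero_mul]
  have t0 := mul_trat_eq c1 c2 c3 c4 (d := mu i (c2+c3) + (1/2)*(c2+1)*(c3+1)) hi hj hij
    (Or.inl ⟨hx, hy, hxy⟩)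
  rw [← hc0] at t0
  simp only [sum_neg_one_zero_one]
  rw [t0, tpp, tpz, tpm, tzp, tzz, tzm, tmp, tmz, tmm, dpp, dpz, dpm, dzp, dzz, dzm, dmp, dmz, dmm]
  have mp : (Nn:ℤ) - (x+1) = Nn - x - 1 := by ring
  have mm : (Nn:ℤ) - (x+(-1)) = Nn - x + 1 := by ring
  rw [mp, mm]
  simp only [add_zero]
  push_cast at hX hY hD hU hS ⊢
  simp only [← sub_eq_add_neg]
  rw [coefS, coefB_eq, coefD_eq] at hX hS
  simp only [muM, muP] at hD hU
  set p0 := racah j y c3 c0 c4 (Nn-x)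
  set q0 := racah i x c1 c2 c3 (Nn-j)
  set q1 := racah i (x+1) c1 c2 c3 (Nn-j)
  set q2 := racah i (x-1) c1 c2 c3 (Nn-j)
  linear_combination Ffun x c1 c2 * q1 * hD + Ffun (-x-c1-c2-1) c1 c2 * q2 * hU
    - (Ffun x c1 c2 + Ffun (-x-c1-c2-1) c1 c2) * q0 * hY - p0 * hX - q0 * p0 * hS
end
end

section
/- Let c1, c2, c3, c4 be generic real numbers, N ≥ 0 an integer, and c0 = −2N−3−c1−c2−c3−c4. For all integers i, j, x, y ≥ 0 with i+j ≤ N and x+y ≤ N, the Griffiths polynomials of Racah type satisfy the duality relation G_{i,j}(x,y; c1,c2,c3,c4; N) / [ Ω(i; c1,c2,c3; N−j) · Λ(j; c4,c0; N) ] = G_{x,y}(i,j; c1,c2,c4,c3; N) / [ Ω(x; c1,c2,c4; N−y) · Λ(y; c3,c0; N) ]. -/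
open Finset

noncomputable section

theorem poch_add (a : ℝ) (m n : ℕ) : poch a (m+n) = poch a m * poch (a+m) n := by
  simp only [poch, Finset.prod_range_add]
  congr 1
  refine Finset.prod_congr rfl fun k _ => ?_
  push_cast
  ring

/-- Reversal of the factors of a Pochhammer symbol. -/
theorem poch_reflect (u v : ℝ) (n : ℕ) (h : v = -u - n + 1) :
    poch u n = (-1:ℝ)^n * poch v n := by
  unfold poch
  rw [← Finset.prod_range_reflect (fun k : ℕ => v + (k:ℝ)), ← Finset.card_range n,
    ← Finset.prod_const, Finset.card_range, ← Finset.prod_mul_distrib]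
  refine Finset.prod_congr rfl fun k hk => ?_
  have hk' : k + 1 ≤ n := Finset.mem_range.mp hk
  rw [Nat.sub_sub, add_comm 1 k, Nat.cast_sub hk', h]
  push_cast
  ring

theorem poch_neg_natCast_eq_zero {n k : ℕ} (h : n < k) : poch (-(n:ℝ)) k = 0 :=
  Finset.prod_eq_zero (Finset.mem_range.mpr h) (by simp)

theorem Generic.add_intCast {r s : ℝ} (h : Generic r) (m : ℤ) (hs : s = r + m) : Generic s := by
  intro k hk
  apply h (k - m)
  push_cast
  linarith

theorem Generic.neg_add_intCast {r s : ℝ} (h : Generic r) (m : ℤ) (hs : s = -r + m) :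
    Generic s := by
  intro k hk
  apply h (m - k)
  push_cast
  linarith

theorem Generic.add_ne_zero {r s : ℝ} (h : Generic r) (m : ℤ) (hs : s = r + m) : s ≠ 0 := by
  simpa using h.add_intCast m hs 0

theorem Generic.poch_ne_zero {r s : ℝ} (h : Generic r) (m : ℤ) (hs : s = r + m) (k : ℕ) :
    poch s k ≠ 0 :=
  Finset.prod_ne_zero_iff.mpr fun l _ =>
    h.add_ne_zero (m + l) (by push_cast; linarith)

/-- The `₄F₃` sum in the Racah polynomial, extended up to `M`. -/
def racahKernel (n x : ℕ) (c1 c2 c3 : ℝ) (M : ℕ) : ℝ :=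
  ∑ k ∈ Finset.range (M + 1),
    (poch (-(n:ℝ)) k * poch ((n:ℝ)+c2+c3+1) k * poch (-(x:ℝ)) k * poch ((x:ℝ)+c1+c2+1) k) /
    (poch (c2+1) k * poch ((M:ℝ)+2+c1+c2+c3) k * poch (-(M:ℝ)) k * (Nat.factorial k : ℝ))

theorem racah_eq_Om_mul_racahKernel {n M : ℕ} (hn : n ≤ M) (x : ℕ) (c1 c2 c3 : ℝ) :
    racah n (x:ℝ) c1 c2 c3 M = Om n c1 c2 c3 M * racahKernel n x c1 c2 c3 M := by
  have h : (0:ℤ) ≤ n ∧ (n:ℤ) ≤ M := ⟨by positivity, by exact_mod_cast hn⟩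
  rw [racah, if_pos h, racahKernel]
  congr 1
  simp only [Int.toNat_natCast, Int.cast_natCast]
  refine Finset.sum_subset (Finset.range_mono (by lia)) fun k _ hk => ?_
  rw [poch_neg_natCast_eq_zero (by simpa using hk)]
  simp

theorem racahKernel_symm (n x : ℕ) (c1 c2 c3 : ℝ) (M : ℕ) :
    racahKernel n x c1 c2 c3 M = racahKernel x n c3 c2 c1 M := by
  refine Finset.sum_congr rfl fun k _ => ?_
  rw [show (x:ℝ)+c1+c2+1 = x+c2+c1+1 by ring, show (n:ℝ)+c2+c3+1 = n+c3+c2+1 by ring,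
    show (M:ℝ)+2+c1+c2+c3 = M+2+c3+c2+c1 by ring]
  ring

theorem Om_natCast (n M : ℕ) (c1 c2 c3 : ℝ) :
    Om n c1 c2 c3 M = (M.choose n : ℝ) * (2*(n:ℝ) + c2 + c3 + 1) *
      poch (c2+1) n * poch ((M:ℝ)+2+c1+c2+c3) n * poch (c1+1) (M-n) /
      (poch (c3+1) n * poch (c2+c3+(n:ℝ)+1) (M+1)) := by
  simp [Om]

theorem Lam_natCast (x M : ℕ) (c1 c2 : ℝ) :
    Lam x c1 c2 M = (-1:ℝ)^x * (M.choose x : ℝ) * (2*(x:ℝ)+c1+c2+1) * poch (c2+1) x /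
      (poch (c1+1) x * poch ((x:ℝ)+c1+c2+1) (M+1)) := by
  simp [Lam]

theorem Generic.two_mul_add_ne_zero {r s : ℝ} (h : Generic r) (n : ℕ) (hs : s = 2*(n:ℝ)+r+1) :
    s ≠ 0 :=
  h.add_ne_zero (2*n+1) (by push_cast; linarith)

theorem Om_ne_zero {n M : ℕ} (hn : n ≤ M) {c1 c2 c3 : ℝ} (h1 : Generic c1) (h2 : Generic c2)
    (h3 : Generic c3) (h23 : Generic (c2+c3)) (h123 : Generic (c1+c2+c3)) :
    Om n c1 c2 c3 M ≠ 0 := by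
  rw [Om_natCast]
  have hc : (M.choose n : ℝ) ≠ 0 := by exact_mod_cast (Nat.choose_pos hn).ne'
  exact div_ne_zero
    (mul_ne_zero (mul_ne_zero (mul_ne_zero (mul_ne_zero hc
      (h23.two_mul_add_ne_zero n (by ring)))
      (h2.poch_ne_zero 1 (by simp) _))
      (h123.poch_ne_zero (M+2) (by push_cast; ring) _))
      (h1.poch_ne_zero 1 (by simp) _))
    (mul_ne_zero (h3.poch_ne_zero 1 (by simp) _)
      (h23.poch_ne_zero (n+1) (by push_cast; ring) _))

theorem Lam_ne_zero {x M : ℕ} (hx : x ≤ M) {c1 c2 : ℝ} (h1 : Generic c1) (h2 : Generic c2)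
    (h12 : Generic (c1+c2)) : Lam x c1 c2 M ≠ 0 := by
  rw [Lam_natCast]
  have hc : (M.choose x : ℝ) ≠ 0 := by exact_mod_cast (Nat.choose_pos hx).ne'
  exact div_ne_zero
    (mul_ne_zero (mul_ne_zero (mul_ne_zero (pow_ne_zero _ (by norm_num)) hc)
      (h12.two_mul_add_ne_zero x (by ring)))
      (h2.poch_ne_zero 1 (by simp) _))
    (mul_ne_zero (h1.poch_ne_zero 1 (by simp) _)
      (h12.poch_ne_zero (x+1) (by push_cast; ring) _))

/-- The normalization `Ω` of the middle Racah factor in terms of the weight `Λ`. -/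
theorem Om_eq_Lam_mul {N a j : ℕ} (haj : a + j ≤ N) {c1 c2 c3 c4 c0 : ℝ}
    (hc0 : c0 = -2*(N:ℝ)-3-c1-c2-c3-c4) (h4 : Generic c4) (h04 : Generic (c0+c4)) :
    Om j c3 c0 c4 (N-a : ℕ) * (N.choose j : ℝ) * poch (c1+c2+a+1) (N-j+1) =
      Lam j c4 c0 N * ((-1:ℝ)^a * ((N-a).choose j : ℝ) * poch (c1+c2+a+1) (N+1) *
        poch (c3+1) (N-a-j) * poch (c1+c2+c3+N-j+2) a) := by
  have haN : a ≤ N := by lia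
  have hjN : j ≤ N := by lia
  have hp4 : poch (c4+1) j ≠ 0 := h4.poch_ne_zero 1 (by simp) _
  have hq : poch (c0+c4+j+1) (N-a+1) ≠ 0 := h04.poch_ne_zero (j+1) (by push_cast; ring) _
  have hr : poch (c0+c4+j+1) (N+1) ≠ 0 := h04.poch_ne_zero (j+1) (by push_cast; ring) _
  have e1 : poch ((N-a:ℕ)+2+c3+c0+c4) j = (-1:ℝ)^j * poch (c1+c2+a+1+(N-j+1:ℕ)) j := by
    apply poch_reflect
    push_cast [Nat.cast_sub haN, Nat.cast_sub hjN]
    rw [hc0]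
    ring
  have e2 : poch (c0+c4+j+1) (N+1) =
      poch (c0+c4+j+1) (N-a+1) * ((-1:ℝ)^a * poch (c1+c2+c3+N-j+2) a) := by
    rw [show N + 1 = (N-a+1) + a by lia, poch_add]
    congr 1
    apply poch_reflect
    push_cast [Nat.cast_sub haN]
    rw [hc0]
    ring
  have e3 : poch (c1+c2+a+1) (N+1) =
      poch (c1+c2+a+1) (N-j+1) * poch (c1+c2+a+1+(N-j+1:ℕ)) j := by
    rw [← poch_add]
    congr 1
    lia
  rw [Om_natCast, Lam_natCast, e1, e3, show (j:ℝ)+c4+c0+1 = c0+c4+j+1 by ring]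
  have hs : ((-1:ℝ)^a * poch (c1+c2+c3+N-j+2) a) =
      poch (c0+c4+j+1) (N+1) / poch (c0+c4+j+1) (N-a+1) := by
    rw [e2]; field_simp
  rw [show ∀ A B C D E : ℝ, (-1:ℝ)^a * A * (B * C) * D * E = A * (B * C) * D * ((-1:ℝ)^a * E) from
    fun _ _ _ _ _ => by ring, hs]
  field_simp
  ring

theorem choose_mul_choose_sub (N a j : ℕ) :
    N.choose a * (N-a).choose j = N.choose j * (N-j).choose a := by
  have h1 := Nat.choose_mul (n := N) (k := a+j) (s := a) (by lia)
  have h2 := Nat.choose_mul (n := N) (k := a+j) (s := j) (by lia)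
  rw [Nat.add_sub_cancel_left] at h1
  rw [Nat.add_sub_cancel] at h2
  rw [← h1, ← h2, ← Nat.choose_symm_add]

/-- Exchange of the normalizations in the summand of the Griffiths polynomial. -/
theorem Om_mul_Om_mul_Lam {N a j y : ℕ} (haj : a + j ≤ N) (hay : a + y ≤ N)
    {c1 c2 c3 c4 c0 : ℝ} (hc0 : c0 = -2*(N:ℝ)-3-c1-c2-c3-c4)
    (h3 : Generic c3) (h4 : Generic c4) (h12 : Generic (c1+c2))
    (h03 : Generic (c0+c3)) (h04 : Generic (c0+c4)) :
    Om j c3 c0 c4 (N-a : ℕ) * Om a c4 c2 c1 (N-y : ℕ) * Lam y c3 c0 N =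
      Om y c4 c0 c3 (N-a : ℕ) * Om a c3 c2 c1 (N-j : ℕ) * Lam j c4 c0 N := by
  have hjN : j ≤ N := by lia
  have hyN : y ≤ N := by lia
  have kj := Om_eq_Lam_mul haj hc0 h4 h04
  have ky := Om_eq_Lam_mul (c3 := c4) (c4 := c3) (c1 := c1) (c2 := c2) (c0 := c0) hay
    (by rw [hc0]; ring) h3 h03
  have hnj : (N.choose j : ℝ) ≠ 0 := by exact_mod_cast (Nat.choose_pos hjN).ne'
  have hny : (N.choose y : ℝ) ≠ 0 := by exact_mod_cast (Nat.choose_pos hyN).ne'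
  have hna : (N.choose a : ℝ) ≠ 0 := by
    exact_mod_cast (Nat.choose_pos (show a ≤ N by lia)).ne'
  have hp (k : ℕ) : poch (c1+c2+a+1) k ≠ 0 := h12.poch_ne_zero (a+1) (by push_cast; ring) _
  have bj : (N.choose a : ℝ) * (N-a).choose j = N.choose j * (N-j).choose a := by
    exact_mod_cast choose_mul_choose_sub N a j
  have bk : (N.choose a : ℝ) * (N-a).choose y = N.choose y * (N-y).choose a := by
    exact_mod_cast choose_mul_choose_sub N a y
  have hpj := hp (N-j+1)
  have hpy := hp (N-y+1)
  have kj' : Om j c3 c0 c4 (N-a : ℕ) = Lam j c4 c0 N * ((-1:ℝ)^a * (N-j).choose a *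
      poch (c1+c2+a+1) (N+1) * poch (c3+1) (N-a-j) * poch (c1+c2+c3+N-j+2) a) /
      (N.choose a * poch (c1+c2+a+1) (N-j+1)) := by
    rw [eq_div_iff (mul_ne_zero hna hpj)]
    apply mul_left_cancel₀ hnj
    linear_combination (N.choose a : ℝ) * kj + Lam j c4 c0 N * ((-1:ℝ)^a *
      poch (c1+c2+a+1) (N+1) * poch (c3+1) (N-a-j) * poch (c1+c2+c3+N-j+2) a) * bj
  have ky' : Om y c4 c0 c3 (N-a : ℕ) = Lam y c3 c0 N * ((-1:ℝ)^a * (N-y).choose a *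
      poch (c1+c2+a+1) (N+1) * poch (c4+1) (N-a-y) * poch (c1+c2+c4+N-y+2) a) /
      (N.choose a * poch (c1+c2+a+1) (N-y+1)) := by
    rw [eq_div_iff (mul_ne_zero hna hpy)]
    apply mul_left_cancel₀ hny
    linear_combination (N.choose a : ℝ) * ky + Lam y c3 c0 N * ((-1:ℝ)^a *
      poch (c1+c2+a+1) (N+1) * poch (c4+1) (N-a-y) * poch (c1+c2+c4+N-y+2) a) * bk
  rw [kj', ky',
    Om_natCast, Om_natCast, Nat.cast_sub hjN, Nat.cast_sub hyN,
    show c2+c1+(a:ℝ)+1 = c1+c2+a+1 by ring,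
    show (N:ℝ)-y+2+c4+c2+c1 = c1+c2+c4+N-y+2 by ring,
    show (N:ℝ)-j+2+c3+c2+c1 = c1+c2+c3+N-j+2 by ring,
    Nat.sub_right_comm N y a, Nat.sub_right_comm N j a]
  ring

theorem racah_eq_zero_of_lt {n M : ℕ} (h : M < n) (x c1 c2 c3 : ℝ) :
    racah n x c1 c2 c3 M = 0 :=
  if_neg fun hn => by lia

/-- The Griffiths polynomial as a sum of products of `₄F₃` sums. -/
theorem grif_eq_sum {N i j x y : ℕ} (hij : i + j ≤ N) (hxy : x + y ≤ N) {c1 c2 c3 c4 c0 : ℝ}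
    (hc0 : c0 = -2*(N:ℝ)-3-c1-c2-c3-c4) :
    grif c1 c2 c3 c4 N i j x y =
      ∑ a ∈ Finset.range (min (N-j) (N-y) + 1), (-1:ℝ)^a *
        (Om i c1 c2 c3 (N-j : ℕ) * racahKernel i a c1 c2 c3 (N-j)) *
        (Om j c3 c0 c4 (N-a : ℕ) * racahKernel j y c3 c0 c4 (N-a)) *
        (Om a c4 c2 c1 (N-y : ℕ) * racahKernel a x c4 c2 c1 (N-y)) := by
  have hjN : j ≤ N := by lia
  have hyN : y ≤ N := by lia
  rw [grif, if_pos (by lia)]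
  simp only [← hc0, ← Nat.cast_sub hjN, ← Nat.cast_sub hyN, Int.toNat_natCast, Int.cast_natCast]
  symm
  refine Finset.sum_subset_zero_on_sdiff (Finset.range_mono (by lia)) (fun a ha => ?_)
    fun a ha => ?_
  · simp only [Finset.mem_sdiff, Finset.mem_range] at ha
    rw [racah_eq_zero_of_lt (n := a) (M := N-y) (by lia), mul_zero]
  · simp only [Finset.mem_range] at ha
    rw [← Nat.cast_sub (show a ≤ N by lia), racah_eq_Om_mul_racahKernel (by lia),
      racah_eq_Om_mul_racahKernel (by lia), racah_eq_Om_mul_racahKernel (by lia)]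

/-- duality relation for the Griffiths polynomials of Racah type. -/
theorem griffiths_duality
    (Nn : ℕ) (c1 c2 c3 c4 : ℝ) (hgen : Generic4 c1 c2 c3 c4)
    (c0 : ℝ) (hc0 : c0 = -2*(Nn:ℝ)-3-c1-c2-c3-c4)
    (i j x y : ℤ) (hi : 0 ≤ i) (hj : 0 ≤ j) (hij : i + j ≤ (Nn:ℤ))
    (hx : 0 ≤ x) (hy : 0 ≤ y) (hxy : x + y ≤ (Nn:ℤ)) :
    grif c1 c2 c3 c4 Nn i j x y / (Om i c1 c2 c3 ((Nn:ℤ)-j) * Lam j c4 c0 (Nn:ℤ)) =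
      grif c1 c2 c4 c3 Nn x y i j / (Om x c1 c2 c4 ((Nn:ℤ)-y) * Lam y c3 c0 (Nn:ℤ)) := by
  obtain ⟨g1, g2, g3, g4, g12, -, -, g23, g24, -, g123, g124, g134, g234, g1234⟩ := hgen
  lift i to ℕ using hi
  lift j to ℕ using hj
  lift x to ℕ using hx
  lift y to ℕ using hy
  have hij' : i + j ≤ Nn := by exact_mod_cast hij
  have hxy' : x + y ≤ Nn := by exact_mod_cast hxy
  have hjN : j ≤ Nn := by lia
  have hyN : y ≤ Nn := by lia
  have g0 : Generic c0 := g1234.neg_add_intCast (-2*Nn-3) (by push_cast; linarith)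
  have g03 : Generic (c0+c3) := g124.neg_add_intCast (-2*Nn-3) (by push_cast; linarith)
  have g04 : Generic (c0+c4) := g123.neg_add_intCast (-2*Nn-3) (by push_cast; linarith)
  rw [grif_eq_sum hij' hxy' hc0, grif_eq_sum (c0 := c0) hxy' hij' (by rw [hc0]; ring),
    min_comm (Nn-y), Finset.sum_div, Finset.sum_div, ← Nat.cast_sub hjN, ← Nat.cast_sub hyN]
  refine Finset.sum_congr rfl fun a ha => ?_
  rw [Finset.mem_range] at ha
  have hOi : Om i c1 c2 c3 (Nn-j : ℕ) ≠ 0 := Om_ne_zero (by lia) g1 g2 g3 g23 g123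
  have hOx : Om x c1 c2 c4 (Nn-y : ℕ) ≠ 0 := Om_ne_zero (by lia) g1 g2 g4 g24 g124
  have hLj : Lam j c4 c0 Nn ≠ 0 := Lam_ne_zero hjN g4 g0 (by rwa [add_comm])
  have hLy : Lam y c3 c0 Nn ≠ 0 := Lam_ne_zero hyN g3 g0 (by rwa [add_comm])
  have key := Om_mul_Om_mul_Lam (N := Nn) (a := a) (j := j) (y := y) (by lia) (by lia) hc0
    g3 g4 g12 g03 g04
  rw [racahKernel_symm x a, racahKernel_symm y j, racahKernel_symm a i, div_eq_div_iff
    (mul_ne_zero hOi hLj) (mul_ne_zero hOx hLy)]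
  linear_combination ((-1:ℝ)^a * Om i c1 c2 c3 (Nn-j : ℕ) * Om x c1 c2 c4 (Nn-y : ℕ) *
    racahKernel i a c1 c2 c3 (Nn-j) * racahKernel j y c3 c0 c4 (Nn-a) *
    racahKernel a x c4 c2 c1 (Nn-y)) * key
end
end
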